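/- Let n, k, r, p be positive integers with 1 < p ≤ r and p ≤ k ≤ n. For every r-coloring χ of an n-element vertex set V there exists a balanced r-coloring χ₀ of V (every color class of χ₀ has size ⌊n/r⌋ or ⌈n/r⌉) such that the number of k-element subsets of V properly (r,p) colored by χ is at most the number of k-element subsets of V properly (r,p) colored by χ₀. Hence the maximum number of properly (r,p) colored k-element subsets over all r-colorings is attained by a balanced r-coloring. -/

import Mathlib

/-- Moving one vertex from a class `A` to a class `B` that is smaller by at least two does not
decrease the number of properly colored sets. -/
theorem move_le {V : Type*} [Fintype V] [DecidableEq V] {r : ℕ} (k p : ℕ) (χ : V → Fin r)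
    (A B : Fin r) (hAB : A ≠ B) (v : V) (hv : χ v = A)
    (hlt : (Finset.univ.filter (fun x => χ x = B)).card + 2 ≤
      (Finset.univ.filter (fun x => χ x = A)).card) :
    (((Finset.univ : Finset V).powersetCard k).filter
          (fun e : Finset V => p ≤ (e.image χ).card)).card ≤
        (((Finset.univ : Finset V).powersetCard k).filter
          (fun e : Finset V => p ≤ (e.image (Function.update χ v B)).card)).card := by
  classical
  set χ' := Function.update χ v B with hχ'
  have hc : Fintype.card {x // χ x = B} ≤ Fintype.card {x // χ x = A ∧ x ≠ v} := by
    rw [Fintype.card_subtype, Fintype.card_subtype]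
    have : (Finset.univ.filter (fun x => χ x = A ∧ x ≠ v)) =
        (Finset.univ.filter (fun x => χ x = A)).erase v := by
      ext x; simp [and_comm]
    rw [this, Finset.card_erase_of_mem (by simp [hv])]
    omega
  obtain ⟨ι⟩ := Function.Embedding.nonempty_of_card_le hc
  let g : V → V := fun x => if h : χ x = B then (ι ⟨x, h⟩ : V) else x
  have gB : ∀ x, χ x = B → χ (g x) = A ∧ g x ≠ v := by
    intro x h
    simp only [g, h, dif_pos]
    exact (ι ⟨x, h⟩).2
  have gN : ∀ x, χ x ≠ B → g x = x := by
    intro x h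
    simp [g, h]
  have ginj : ∀ x y, (χ x = A → x = v) → (χ y = A → y = v) → g x = g y → x = y := by
    intro x y hx hy h
    by_cases h1 : χ x = B <;> by_cases h2 : χ y = B
    · simp only [g, h1, h2, dif_pos] at h
      have := ι.injective (Subtype.ext h)
      simpa using this
    · have := gB x h1
      rw [h, gN y h2] at this
      exact absurd (hy this.1) this.2
    · have := gB y h2
      rw [← h, gN x h1] at this
      exact absurd (hx this.1) this.2
    · rwa [gN x h1, gN y h2] at h
  have gv : g v = v := gN v (by rw [hv]; exact hAB)
  have im1 : ∀ f : Finset V, v ∉ f → f.image χ' = f.image χ := by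
    intro f hf
    apply Finset.image_congr
    intro x hx
    have : x ≠ v := fun h => hf (h ▸ hx)
    simp [hχ', this]
  have im2 : ∀ f : Finset V, (insert v f).image χ = insert A (f.image χ) := by
    intro f; rw [Finset.image_insert, hv]
  have im3 : ∀ f : Finset V, v ∉ f → (insert v f).image χ' = insert B (f.image χ) := by
    intro f hf; rw [Finset.image_insert, im1 f hf]; simp [hχ']
  have key : ∀ e : Finset V, p ≤ (e.image χ).card → ¬ p ≤ (e.image χ').card →
      ∃ f, v ∉ f ∧ e = insert v f ∧ A ∉ f.image χ ∧ B ∈ f.image χ ∧ (f.image χ).card + 1 = p := by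
    intro e h1 h2
    have hve : v ∈ e := by
      by_contra h
      rw [im1 e h] at h2
      exact h2 h1
    refine ⟨e.erase v, by simp, (Finset.insert_erase hve).symm, ?_⟩
    rw [← Finset.insert_erase hve] at h1 h2
    rw [im2] at h1
    rw [im3 _ (by simp)] at h2
    generalize (e.erase v).image χ = F at *
    rw [Finset.card_insert_eq_ite] at h1 h2
    split_ifs at h1 h2 <;> first | omega | (refine ⟨by assumption, by assumption, by omega⟩)
  rw [← Finset.card_sdiff_le_card_sdiff_iff]
  apply Finset.card_le_card_of_injOn (fun e => e.image g)
  · intro e he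
    simp only [Finset.coe_sdiff, Finset.mem_coe, Set.mem_sdiff, Finset.mem_filter,
      Finset.mem_powersetCard, Finset.subset_univ, true_and, not_and] at he ⊢
    obtain ⟨⟨hk, h1⟩, h2⟩ := he
    obtain ⟨f, hvf, rfl, hA, hB, hcard⟩ := key e h1 (h2 hk)
    have hfA : ∀ x ∈ f, χ x ≠ A := fun x hx h => hA (h ▸ Finset.mem_image_of_mem χ hx)
    have hgf : v ∉ f.image g := by
      intro h
      obtain ⟨x, hx, hxv⟩ := Finset.mem_image.1 h
      by_cases hxB : χ x = B
      · exact (gB x hxB).2 hxv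
      · rw [gN x hxB] at hxv
        exact hvf (hxv ▸ hx)
    have hF : (f.image g).image χ = (f.image χ).image (Equiv.swap A B) := by
      rw [Finset.image_image, Finset.image_image]
      apply Finset.image_congr
      intro x hx
      by_cases hxB : χ x = B
      · simp [hxB, (gB x hxB).1]
      · simp [gN x hxB, Equiv.swap_apply_of_ne_of_ne (hfA x hx) hxB]
    have hFc : ((f.image g).image χ).card = (f.image χ).card := by
      rw [hF, Finset.card_image_of_injective _ (Equiv.injective _)]
    have hFA : A ∈ (f.image g).image χ := by
      rw [hF]
      exact Finset.mem_image.2 ⟨B, hB, by simp⟩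
    have hFB : B ∉ (f.image g).image χ := by
      rw [hF]
      intro h
      obtain ⟨c, hc, hcB⟩ := Finset.mem_image.1 h
      have : c = A := by
        apply (Equiv.swap A B).injective
        rw [hcB]; simp
      exact hA (this ▸ hc)
    have hcard2 : ((insert v f).image g).card = k := by
      rw [Finset.card_image_of_injOn, hk]
      intro x hx y hy
      apply ginj
      · intro h
        rcases Finset.mem_insert.1 hx with h' | h'
        · exact h'
        · exact absurd h (hfA x h')
      · intro h
        rcases Finset.mem_insert.1 hy with h' | h'
        · exact h'
        · exact absurd h (hfA y h')
    have hg : (insert v f).image g = insert v (f.image g) := by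
      rw [Finset.image_insert, gv]
    refine ⟨⟨hcard2, ?_⟩, fun _ => ?_⟩
    · rw [hg, im3 _ hgf, Finset.card_insert_of_notMem hFB]
      omega
    · rw [hg, im2, Finset.insert_eq_of_mem hFA]
      omega
  · have hS : ∀ e ∈ (((Finset.univ : Finset V).powersetCard k).filter
          (fun e : Finset V => p ≤ (e.image χ).card)) \
          (((Finset.univ : Finset V).powersetCard k).filter
          (fun e : Finset V => p ≤ (e.image χ').card)), ∀ x ∈ e, χ x = A → x = v := by
      intro e he x hx h
      simp only [Finset.mem_sdiff, Finset.mem_filter,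
        Finset.mem_powersetCard, Finset.subset_univ, true_and, not_and] at he
      obtain ⟨⟨hk, h1⟩, h2⟩ := he
      obtain ⟨f, hvf, rfl, hA, hB, hcard⟩ := key e h1 (h2 hk)
      rcases Finset.mem_insert.1 hx with h' | h'
      · exact h'
      · exact absurd (h ▸ Finset.mem_image_of_mem χ h') hA
    have hsub : ∀ e₁ e₂ : Finset V, (∀ x ∈ e₁, χ x = A → x = v) → (∀ x ∈ e₂, χ x = A → x = v) →
        e₁.image g = e₂.image g → e₁ ⊆ e₂ := by
      intro e₁ e₂ h1 h2 h x hx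
      have : g x ∈ e₂.image g := h ▸ Finset.mem_image_of_mem g hx
      obtain ⟨y, hy, hyx⟩ := Finset.mem_image.1 this
      rwa [← ginj y x (h2 y hy) (h1 x hx) hyx]
    intro e₁ h1 e₂ h2 h
    exact Finset.Subset.antisymm (hsub _ _ (hS _ h1) (hS _ h2) h)
      (hsub _ _ (hS _ h2) (hS _ h1) h.symm)

/-- The move decreases the sum of squares of the class sizes. -/
theorem move_sq {V : Type*} [Fintype V] [DecidableEq V] {r : ℕ} (χ : V → Fin r)
    (A B : Fin r) (hAB : A ≠ B) (v : V) (hv : χ v = A)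
    (hlt : (Finset.univ.filter (fun x => χ x = B)).card + 2 ≤
      (Finset.univ.filter (fun x => χ x = A)).card) :
    ∑ c, (Finset.univ.filter (fun x => Function.update χ v B x = c)).card ^ 2 <
      ∑ c, (Finset.univ.filter (fun x => χ x = c)).card ^ 2 := by
  have hA : (Finset.univ.filter (fun x => Function.update χ v B x = A)).card + 1 =
      (Finset.univ.filter (fun x => χ x = A)).card := by
    have : (Finset.univ.filter (fun x => Function.update χ v B x = A)) =
        (Finset.univ.filter (fun x => χ x = A)).erase v := by
      ext x
      by_cases h : x = v
      · simp [h, hAB.symm]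
      · simp [h]
    rw [this, Finset.card_erase_add_one (by simp [hv])]
  have hB : (Finset.univ.filter (fun x => Function.update χ v B x = B)).card =
      (Finset.univ.filter (fun x => χ x = B)).card + 1 := by
    have : (Finset.univ.filter (fun x => Function.update χ v B x = B)) =
        insert v (Finset.univ.filter (fun x => χ x = B)) := by
      ext x
      by_cases h : x = v
      · simp [h]
      · simp [h]
    rw [this, Finset.card_insert_of_notMem (by simp [hv, hAB])]
  have hO : ∀ c ∈ (Finset.univ.erase A).erase B,
      (Finset.univ.filter (fun x => Function.update χ v B x = c)).card ^ 2 =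
      (Finset.univ.filter (fun x => χ x = c)).card ^ 2 := by
    intro c hc
    simp only [Finset.mem_erase, Finset.mem_univ, and_true] at hc
    congr 2
    ext x
    by_cases h : x = v
    · simp [h, hv, hc.1.symm, hc.2.symm]
    · simp [h]
  have hBm : B ∈ (Finset.univ : Finset (Fin r)).erase A := by simp [hAB.symm]
  rw [← Finset.add_sum_erase _ _ (Finset.mem_univ A), ← Finset.add_sum_erase _ _ hBm,
    Finset.sum_congr rfl hO, ← Finset.add_sum_erase _ (fun c =>
      (Finset.univ.filter (fun x => χ x = c)).card ^ 2) (Finset.mem_univ A),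
    ← Finset.add_sum_erase _ (fun c =>
      (Finset.univ.filter (fun x => χ x = c)).card ^ 2) hBm]
  simp only [hB, ← hA]
  nlinarith

/-- For every `r`-coloring of an `n`-element vertex set there is a balanced `r`-coloring (all
color classes of size `⌊n/r⌋` or `⌈n/r⌉`) that properly `(r,p)` colors at least as many
`k`-element subsets; hence the maximum is attained by a balanced coloring. -/
theorem stmt_6 (n k r p : ℕ) (hn : 0 < n) (hk : 0 < k) (hr : 0 < r) (hp : 1 < p)
    (hpr : p ≤ r) (hpk : p ≤ k) (hkn : k ≤ n)
    (V : Type*) [Fintype V] [DecidableEq V] (hV : Fintype.card V = n)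
    (χ : V → Fin r) :
    ∃ χ₀ : V → Fin r,
      (∀ c : Fin r,
        (Finset.univ.filter (fun v => χ₀ v = c)).card = n / r ∨
          (Finset.univ.filter (fun v => χ₀ v = c)).card = (n + r - 1) / r) ∧
      (((Finset.univ : Finset V).powersetCard k).filter
          (fun e : Finset V => p ≤ (e.image χ).card)).card ≤
        (((Finset.univ : Finset V).powersetCard k).filter
          (fun e : Finset V => p ≤ (e.image χ₀).card)).card := by
  classical
  let N : (V → Fin r) → ℕ := fun χ => (((Finset.univ : Finset V).powersetCard k).filter
          (fun e : Finset V => p ≤ (e.image χ).card)).card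
  let Q : (V → Fin r) → ℕ := fun χ => ∑ c, (Finset.univ.filter (fun x => χ x = c)).card ^ 2
  obtain ⟨χ₀, h0, hmin⟩ := Finset.exists_min_image
    (Finset.univ.filter (fun ψ : V → Fin r => N χ ≤ N ψ)) Q ⟨χ, by simp⟩
  simp only [Finset.mem_filter, Finset.mem_univ, true_and] at h0 hmin
  refine ⟨χ₀, ?_, h0⟩
  have hbal : ∀ c d : Fin r, (Finset.univ.filter (fun x => χ₀ x = c)).card ≤
      (Finset.univ.filter (fun x => χ₀ x = d)).card + 1 := by
    intro c d
    by_contra hcon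
    have hlt : (Finset.univ.filter (fun x => χ₀ x = d)).card + 2 ≤
      (Finset.univ.filter (fun x => χ₀ x = c)).card := by omega
    have hcd : c ≠ d := by
      rintro rfl
      omega
    obtain ⟨v, hv⟩ := Finset.card_pos.1 (show 0 <
      (Finset.univ.filter (fun x => χ₀ x = c)).card by omega)
    have hv' : χ₀ v = c := by simpa using hv
    have h1 := move_le k p χ₀ c d hcd v hv' hlt
    have h2 := move_sq χ₀ c d hcd v hv' hlt
    exact absurd (hmin (Function.update χ₀ v d) (h0.trans h1)) (not_le.2 h2)
  have hsum : ∑ c, (Finset.univ.filter (fun x => χ₀ x = c)).card = n := by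
    rw [← hV, ← Finset.card_univ]
    exact (Finset.card_eq_sum_card_fiberwise (fun x _ => Finset.mem_coe.2 (Finset.mem_univ _))).symm
  intro c
  set s : Fin r → ℕ := fun c => (Finset.univ.filter (fun x => χ₀ x = c)).card with hs
  change s c = n / r ∨ s c = (n + r - 1) / r
  change ∑ c, s c = n at hsum
  have hb : ∀ c d, s c ≤ s d + 1 := hbal
  have hu : n < r * (s c + 1) := by
    rw [← hsum]
    have : ∑ d, s d < ∑ d : Fin r, (s c + 1) :=
      Finset.sum_lt_sum (fun d _ => hb d c) ⟨c, Finset.mem_univ _, by omega⟩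
    simpa using this
  have hl : r * s c < n + r := by
    rw [← hsum]
    have : ∑ d : Fin r, s c < ∑ d, (s d + 1) :=
      Finset.sum_lt_sum (fun d _ => hb c d) ⟨c, Finset.mem_univ _, by omega⟩
    simpa [Finset.sum_add_distrib] using this
  by_cases hcase : r * s c ≤ n
  · left
    symm
    rw [Nat.div_eq_iff hr]
    have e1 : s c * r = r * s c := Nat.mul_comm _ _
    rw [Nat.mul_succ] at hu
    constructor <;> omega
  · right
    symm
    rw [Nat.div_eq_iff hr]
    have e1 : s c * r = r * s c := Nat.mul_comm _ _
    constructor <;> omega
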